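/- Let R be a unital ring and a, b, c ∈ R such that cab is regular with inner inverse t. Let x = b t c. Then the following are equivalent: (1) xax = x and x° = c°; (2) xax = x and x° ⊆ c°; (3) cR = cabR. -/

import Mathlib

theorem inner_inverse_tfae_c {R : Type*} [Ring R] (a b c t : R)
    (ht : c * a * b * t * (c * a * b) = c * a * b) (x : R) (hx : x = b * t * c) :
    List.TFAE
      [x * a * x = x ∧ {r : R | x * r = 0} = {r : R | c * r = 0},
       x * a * x = x ∧ {r : R | x * r = 0} ⊆ {r : R | c * r = 0},
       {z : R | ∃ r : R, z = c * r} = {z : R | ∃ r : R, z = c * a * b * r}] := by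
  tfae_have 1 → 2 := fun h => ⟨h.1, h.2.subset⟩
  tfae_have 2 → 3 := by
    rintro ⟨hxax, hsub⟩
    have hmem : c * (1 - a * x) = 0 :=
      hsub (show x * (1 - a * x) = 0 by rw [mul_sub, mul_one, ← mul_assoc, hxax, sub_self])
    have hc : c = c * a * x := by
      rwa [mul_sub, mul_one, ← mul_assoc, sub_eq_zero] at hmem
    ext z
    constructor
    · rintro ⟨r, rfl⟩
      refine ⟨t * c * r, ?_⟩
      calc c * r = c * a * x * r := by rw [← hc]
        _ = c * a * b * (t * c * r) := by simp only [hx, mul_assoc]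
    · rintro ⟨r, rfl⟩
      exact ⟨a * b * r, by simp only [mul_assoc]⟩
  tfae_have 3 → 1 := by
    intro h
    obtain ⟨r, hr⟩ : ∃ r : R, c = c * a * b * r :=
      h.subset (show ∃ r : R, c = c * r from ⟨1, (mul_one c).symm⟩)
    have hc : c * a * x = c := by
      calc c * a * x = c * a * b * t * c := by simp only [hx, mul_assoc]
        _ = c * a * b * t * (c * a * b * r) := by rw [← hr]
        _ = c * a * b * t * (c * a * b) * r := by simp only [mul_assoc]
        _ = c := by rw [ht, ← hr]
    refine ⟨?_, Set.ext fun s => ⟨fun hs => ?_, fun hs => ?_⟩⟩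
    · calc x * a * x = b * t * (c * a * x) := by simp only [hx, mul_assoc]
        _ = x := by rw [hc, hx]
    · change x * s = 0 at hs
      change c * s = 0
      rw [← hc, mul_assoc, hs, mul_zero]
    · change c * s = 0 at hs
      change x * s = 0
      rw [hx, mul_assoc, hs, mul_zero]
  tfae_finish
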